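/- Fix n ≥ 1 and work in the exterior-form model Σ := ⋀•(ℂ^{2n−1}) with ω := Σ_{p=1}^{n−1} y_{2p}∧y_{2p+1}, and for −1 ≤ k ≤ n−1 let ψ_k := ω^{k+1} − i(k+1)·y₁∧ω^k (conventions ω^{−1} = 0, ω⁰ = 1). Then for every −1 ≤ k ≤ n−1: (1) c₁(ψ_k) = i·ω^{k+1} − (k+1)·y₁∧ω^k; (2) c₂(ψ_k) = i·y₁∧ω^{k+1} + (k+1)·ω^k; (3) c₃(ψ_k) = y₁∧ω^{k+1} + i(k+1)·ω^k. (These are the Clifford products ξ_i·ψ_k of the Reeb vector fields with the invariant Killing spinors of a homogeneous 3-Sasakian space.) -/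

import Mathlib

noncomputable section

/-- The underlying `(2n-1)`-dimensional complex vector space `ℂ^{2n-1}`. -/
abbrev ModelV (n : ℕ) : Type := Fin (2 * n - 1) → ℂ

/-- The exterior-form model `Σ = ⋀•(ℂ^{2n-1})` of the spinor module. -/
abbrev SpinorModel (n : ℕ) : Type := ExteriorAlgebra ℂ (ModelV n)

/-- The generator `y_{j+1}` (so `j` is the 0-based index), with junk value `0` out of range. -/
def yGen (n j : ℕ) : SpinorModel n :=
  if h : j < 2 * n - 1 then
    ExteriorAlgebra.ι ℂ (Pi.single (⟨j, h⟩ : Fin (2 * n - 1)) (1 : ℂ))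
  else 0

/-- Left exterior multiplication `y_{j+1} ∧ ·` (0-based index `j`). -/
def wdg (n j : ℕ) : SpinorModel n →ₗ[ℂ] SpinorModel n :=
  LinearMap.mulLeft ℂ (yGen n j)

/-- Contraction `x_{j+1} ⌟ ·` with the `(j+1)`-st dual basis vector (0-based index `j`),
with junk value `0` out of range. -/
def ctr (n j : ℕ) : SpinorModel n →ₗ[ℂ] SpinorModel n :=
  if h : j < 2 * n - 1 then
    CliffordAlgebra.contractLeft (LinearMap.proj (⟨j, h⟩ : Fin (2 * n - 1)))
  else 0

/-- The Clifford multiplication operators `c_a`, `1 ≤ a ≤ 4n-1`, of the exterior-form model: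
`c₁ = i·Id` on even degrees and `-i·Id` on odd degrees, `c_{2j} = i(x_j⌟ + y_j∧)` and
`c_{2j+1} = y_j∧ - x_j⌟` for `1 ≤ j ≤ 2n-1` (1-based indices). -/
def cop (n a : ℕ) : SpinorModel n →ₗ[ℂ] SpinorModel n :=
  if a = 1 then
    Complex.I • (CliffordAlgebra.involute : SpinorModel n →ₐ[ℂ] SpinorModel n).toLinearMap
  else if a % 2 = 0 then Complex.I • (ctr n (a / 2 - 1) + wdg n (a / 2 - 1))
  else wdg n (a / 2 - 1) - ctr n (a / 2 - 1)

/-- The invariant `2`-form `ω = ∑_{p=1}^{n-1} y_{2p} ∧ y_{2p+1}`. -/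
def om (n : ℕ) : SpinorModel n :=
  ∑ p ∈ Finset.Icc 1 (n - 1), yGen n (2 * p - 1) * yGen n (2 * p)

/-- The invariant Killing spinors `ψ_k = ω^{k+1} - i(k+1)·y₁∧ω^k`, reindexed by
`j = k + 1` (so `psi n j` is `ψ_{j-1}`, and `psi n 0 = ψ_{-1} = 1`). -/
def psi (n j : ℕ) : SpinorModel n :=
  om n ^ j - (Complex.I * (j : ℂ)) • (yGen n 0 * om n ^ (j - 1))

/-- The space of invariant spinors `Σ_inv = span_ℂ{ω^k, y₁∧ω^k : 0 ≤ k ≤ n-1}`. -/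
def Sinv (n : ℕ) : Submodule ℂ (SpinorModel n) :=
  Submodule.span ℂ {x | ∃ k ≤ n - 1, x = om n ^ k ∨ x = yGen n 0 * om n ^ k}

/-- The space of invariant Killing spinors `K = span_ℂ{ψ_k : -1 ≤ k ≤ n-1}`. -/
def KSpan (n : ℕ) : Submodule ℂ (SpinorModel n) :=
  Submodule.span ℂ {x | ∃ j ≤ n, x = psi n j}


theorem yGen_mul_self (n k : ℕ) : yGen n k * yGen n k = 0 := by
  unfold yGen
  split_ifs
  · exact ExteriorAlgebra.ι_sq_zero _
  · exact mul_zero _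

theorem involute_yGen (n k : ℕ) :
    (CliffordAlgebra.involute : SpinorModel n →ₐ[ℂ] SpinorModel n) (yGen n k) = -yGen n k := by
  unfold yGen
  split_ifs
  · exact CliffordAlgebra.involute_ι _
  · simp

theorem involute_om (n : ℕ) :
    (CliffordAlgebra.involute : SpinorModel n →ₐ[ℂ] SpinorModel n) (om n) = om n := by
  simp only [om, map_sum, map_mul, involute_yGen, neg_mul_neg]

theorem ctr_one (n k : ℕ) : ctr n k 1 = 0 := by
  unfold ctr
  split_ifs
  · exact CliffordAlgebra.contractLeft_one (Q := 0) _
  · rfl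

theorem ctr_yGen_mul_self {n k : ℕ} (hk : k < 2 * n - 1) (x : SpinorModel n) :
    ctr n k (yGen n k * x) = x - yGen n k * ctr n k x := by
  simp only [ctr, yGen, dif_pos hk]
  refine (CliffordAlgebra.contractLeft_ι_mul _ _ _).trans ?_
  simp [ExteriorAlgebra.ι]

theorem ctr_yGen_mul_of_ne {n k l : ℕ} (hkl : k ≠ l) (x : SpinorModel n) :
    ctr n k (yGen n l * x) = -(yGen n l * ctr n k x) := by
  unfold ctr yGen
  split_ifs with hk hl
  · refine (CliffordAlgebra.contractLeft_ι_mul _ _ _).trans ?_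
    have hne : (⟨k, hk⟩ : Fin (2 * n - 1)) ≠ ⟨l, hl⟩ := by simpa using hkl
    simp [ExteriorAlgebra.ι, Pi.single_eq_of_ne hne]
  all_goals simp

theorem ctr_zero_om_mul (n : ℕ) (x : SpinorModel n) :
    ctr n 0 (om n * x) = om n * ctr n 0 x := by
  simp only [om, Finset.sum_mul, map_sum]
  refine Finset.sum_congr rfl fun p hp => ?_
  have hp1 := (Finset.mem_Icc.mp hp).1
  rw [mul_assoc, ctr_yGen_mul_of_ne (by omega), ctr_yGen_mul_of_ne (by omega), mul_neg, neg_neg,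
    mul_assoc]

theorem ctr_zero_om_pow (n m : ℕ) : ctr n 0 (om n ^ m) = 0 := by
  induction m with
  | zero => rw [pow_zero, ctr_one]
  | succ m ih => rw [pow_succ', ctr_zero_om_mul, ih, mul_zero]

theorem involute_psi (n j : ℕ) :
    (CliffordAlgebra.involute : SpinorModel n →ₐ[ℂ] SpinorModel n) (psi n j) =
      om n ^ j + (Complex.I * (j : ℂ)) • (yGen n 0 * om n ^ (j - 1)) := by
  simp only [psi, map_sub, map_smul, map_mul, map_pow, involute_yGen, involute_om, neg_mul,
    smul_neg, sub_neg_eq_add]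

theorem ctr_zero_psi {n : ℕ} (hn : 1 ≤ n) (j : ℕ) :
    ctr n 0 (psi n j) = -((Complex.I * (j : ℂ)) • om n ^ (j - 1)) := by
  rw [psi, map_sub, map_smul, ctr_yGen_mul_self (by omega), ctr_zero_om_pow, ctr_zero_om_pow,
    mul_zero, sub_zero, zero_sub]

theorem wdg_zero_psi (n j : ℕ) : wdg n 0 (psi n j) = yGen n 0 * om n ^ j := by
  rw [wdg, LinearMap.mulLeft_apply, psi, mul_sub, mul_smul_comm, ← mul_assoc, yGen_mul_self,
    zero_mul, smul_zero, sub_zero]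

/-- The Clifford products of the Reeb directions with the invariant
Killing spinors `ψ_k = ω^{k+1} - i(k+1)·y₁∧ω^k` (`-1 ≤ k ≤ n-1`, here reindexed by
`j = k+1 ∈ {0,…,n}`) are: `c₁(ψ_k) = i·ω^{k+1} - (k+1)·y₁∧ω^k`,
`c₂(ψ_k) = i·y₁∧ω^{k+1} + (k+1)·ω^k`, and `c₃(ψ_k) = y₁∧ω^{k+1} + i(k+1)·ω^k`. -/
theorem clifford_reeb_psi (n : ℕ) (hn : 1 ≤ n) (j : ℕ) (hj : j ≤ n) :
    cop n 1 (psi n j) = Complex.I • om n ^ j - (j : ℂ) • (yGen n 0 * om n ^ (j - 1)) ∧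
    cop n 2 (psi n j) = Complex.I • (yGen n 0 * om n ^ j) + (j : ℂ) • om n ^ (j - 1) ∧
    cop n 3 (psi n j) = yGen n 0 * om n ^ j + (Complex.I * (j : ℂ)) • om n ^ (j - 1) := by
  have hI (z : ℂ) : Complex.I * (Complex.I * z) = -z := by
    rw [← mul_assoc, Complex.I_mul_I, neg_one_mul]
  refine ⟨?_, ?_, ?_⟩
  · change Complex.I • (CliffordAlgebra.involute : SpinorModel n →ₐ[ℂ] SpinorModel n) (psi n j) = _
    rw [involute_psi, smul_add, smul_smul, hI, neg_smul, sub_eq_add_neg]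
  · change Complex.I • (ctr n 0 (psi n j) + wdg n 0 (psi n j)) = _
    rw [ctr_zero_psi hn, wdg_zero_psi, smul_add, smul_neg, smul_smul, hI, neg_smul, neg_neg,
      add_comm]
  · change wdg n 0 (psi n j) - ctr n 0 (psi n j) = _
    rw [ctr_zero_psi hn, wdg_zero_psi, sub_neg_eq_add]
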